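/- Let s = 2^x·D where x ≥ 0 is an integer and D ∈ {1, 3, 5}. Then the constant term c_0[Δ^{−s}] of the Fourier expansion of Δ^{−s} at infinity (an integer, equal to the coefficient of q^s in Π_{m≥1}(1−q^m)^{−24s}) has 2-adic valuation exactly 3·d_2(s), where d_2(s) is the sum of the binary digits of s. -/

import Mathlib

open Complex Filter UpperHalfPlane
open scoped MatrixGroups ModularForm Manifold

noncomputable section

/-- `q = e^{2πiz}`. -/
def qexp (z : ℂ) : ℂ := Complex.exp (2 * Real.pi * Complex.I * z)

/-- `σ^odd(n) = Σ_{d∣n, d odd} d`. -/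
def sigmaOdd (n : ℕ) : ℕ := ∑ d ∈ n.divisors.filter (fun d => Odd d), d

/-- `σ₃^alt(n) = Σ_{d∣n} (-1)^d d³`. -/
def sigma3Alt (n : ℕ) : ℤ := ∑ d ∈ n.divisors, (-1 : ℤ) ^ d * (d : ℤ) ^ 3

/-- `σ*_{2,3}(n) = Σ_{d∣n, n/d odd} d³`. -/
def sigmaStar3 (n : ℕ) : ℕ := ∑ d ∈ n.divisors.filter (fun d => Odd (n / d)), d ^ 3

/-- `E_{γ,2} = 1 + 24 Σ σ^odd(n) qⁿ`. -/
def Egamma2 (z : ℂ) : ℂ := 1 + 24 * ∑' n : ℕ+, (sigmaOdd n : ℂ) * qexp z ^ (n : ℕ)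

/-- `E_{0,4} = 1 + 16 Σ σ₃^alt(n) qⁿ`. -/
def E04 (z : ℂ) : ℂ := 1 + 16 * ∑' n : ℕ+, (sigma3Alt n : ℂ) * qexp z ^ (n : ℕ)

/-- `E_{∞,4} = Σ σ*_{2,3}(n) qⁿ`. -/
def Einf4 (z : ℂ) : ℂ := ∑' n : ℕ+, (sigmaStar3 n : ℂ) * qexp z ^ (n : ℕ)

/-- `j₂ = E_{γ,2}² / E_{∞,4}`. -/
def j2 (z : ℂ) : ℂ := Egamma2 z ^ 2 / Einf4 z

open PowerSeries (coeff)
open scoped PowerSeries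
open Topology Asymptotics

/-- The partial product `Π_{1≤m≤K}(1−Xᵐ)` as a formal power series. -/
def eulerProd (K : ℕ) : ℤ⟦X⟧ := ∏ m ∈ Finset.range K, (1 - PowerSeries.X ^ (m + 1))

lemma eulerProd_succ (K : ℕ) :
    eulerProd (K + 1) = eulerProd K * (1 - PowerSeries.X ^ (K + 1)) :=
  Finset.prod_range_succ _ _

lemma isUnit_eulerProd (K : ℕ) : IsUnit (eulerProd K) := by
  simp [PowerSeries.isUnit_iff_constantCoeff, eulerProd]

lemma two_dvd_eulerProd_sq_sub_expand (K : ℕ) :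
    (2 : ℤ⟦X⟧) ∣ eulerProd K ^ 2 - PowerSeries.expand 2 two_ne_zero (eulerProd K) := by
  induction K with
  | zero => simp [eulerProd]
  | succ K ih =>
    obtain ⟨c, hc⟩ := ih
    rw [eulerProd_succ, map_mul, map_sub, map_one, map_pow, PowerSeries.expand_X]
    set e := PowerSeries.expand 2 two_ne_zero (eulerProd K)
    set y : ℤ⟦X⟧ := PowerSeries.X ^ (K + 1) with hy
    have hy2 : (PowerSeries.X ^ 2 : ℤ⟦X⟧) ^ (K + 1) = y ^ 2 := by rw [hy]; ring
    rw [hy2]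
    exact ⟨c * (1 - y) ^ 2 + e * (y ^ 2 - y), by linear_combination (1 - y) ^ 2 * hc⟩

/-- If `U² ≡ U(X²) mod 2` then the inverse `V` of `U` satisfies the same congruence. -/
lemma two_dvd_inv_sq_sub_expand {U V : ℤ⟦X⟧} (hUV : U * V = 1)
    (hU : (2 : ℤ⟦X⟧) ∣ U ^ 2 - PowerSeries.expand 2 two_ne_zero U) :
    (2 : ℤ⟦X⟧) ∣ V ^ 2 - PowerSeries.expand 2 two_ne_zero V := by
  have h : PowerSeries.expand 2 two_ne_zero U * PowerSeries.expand 2 two_ne_zero V = 1 := by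
    rw [← map_mul, hUV, map_one]
  obtain ⟨c, hc⟩ := hU
  set u := PowerSeries.expand 2 two_ne_zero U
  set v := PowerSeries.expand 2 two_ne_zero V
  refine ⟨-(V ^ 2 * v * c), ?_⟩
  linear_combination (-V ^ 2 * v) * hc + v * (U * V + 1) * hUV - V ^ 2 * h

lemma dvd_coeff_of_dvd {k : ℤ} {F : ℤ⟦X⟧} (h : PowerSeries.C k ∣ F) (n : ℕ) :
    k ∣ coeff n F := by
  obtain ⟨G, rfl⟩ := h
  rw [PowerSeries.coeff_C_mul]
  exact dvd_mul_right _ _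

/-- Doubling congruence: `[X^{2s}] V^{48s} ≡ [X^s] V^{24s} mod 2^{x+4}` for `s = 2^x·D`. -/
lemma coeff_doubling {V : ℤ⟦X⟧}
    (hV : (2 : ℤ⟦X⟧) ∣ V ^ 2 - PowerSeries.expand 2 two_ne_zero V) (x D : ℕ) :
    (2 : ℤ) ^ (x + 4) ∣ coeff (2 ^ (x + 1) * D) (V ^ (24 * (2 ^ (x + 1) * D))) -
      coeff (2 ^ x * D) (V ^ (24 * (2 ^ x * D))) := by
  have h1 : (2 : ℤ⟦X⟧) ^ (x + 4) ∣
      (V ^ 2) ^ 2 ^ (x + 3) - (PowerSeries.expand 2 two_ne_zero V) ^ 2 ^ (x + 3) := by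
    simpa using dvd_sub_pow_of_dvd_sub (p := 2) (by simpa using hV) (x + 3)
  have h2 := h1.trans (sub_dvd_pow_sub_pow _ _ (3 * D))
  have e1 : 2 * (2 ^ (x + 3) * (3 * D)) = 24 * (2 ^ (x + 1) * D) := by ring
  have e2 : 2 ^ (x + 3) * (3 * D) = 24 * (2 ^ x * D) := by ring
  rw [← pow_mul, ← pow_mul, ← pow_mul, e1, e2] at h2
  have e3 : 2 ^ (x + 1) * D = 2 * (2 ^ x * D) := by ring
  have h3 := dvd_coeff_of_dvd (k := 2 ^ (x + 4)) (by simpa using h2) (2 ^ (x + 1) * D)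
  have h4 : coeff (2 ^ (x + 1) * D) (PowerSeries.expand 2 two_ne_zero V ^ (24 * (2 ^ x * D))) =
      coeff (2 ^ x * D) (V ^ (24 * (2 ^ x * D))) := by
    rw [← map_pow, e3, PowerSeries.coeff_expand_mul]
  rwa [map_sub, h4] at h3

/-- The ideal of power series vanishing modulo `128` up to degree `40`. -/
def truncIdeal : Ideal ℤ⟦X⟧ := Ideal.span {PowerSeries.C 128, PowerSeries.X ^ 41}

lemma dvd_coeff_of_mem_truncIdeal {F : ℤ⟦X⟧} (h : F ∈ truncIdeal) {n : ℕ} (hn : n < 41) :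
    (128 : ℤ) ∣ coeff n F := by
  obtain ⟨a, b, rfl⟩ := Ideal.mem_span_pair.1 h
  rw [map_add, PowerSeries.coeff_mul_X_pow', if_neg (by omega), add_zero]
  exact dvd_coeff_of_dvd (dvd_mul_left _ _) n

lemma mem_truncIdeal_of_C_dvd {F : ℤ⟦X⟧} (h : PowerSeries.C 128 ∣ F) : F ∈ truncIdeal :=
  Ideal.mem_of_dvd _ h (Ideal.subset_span (by simp))

lemma mem_truncIdeal_of_X_pow_dvd {F : ℤ⟦X⟧} (h : PowerSeries.X ^ 41 ∣ F) : F ∈ truncIdeal :=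
  Ideal.mem_of_dvd _ h (Ideal.subset_span (by simp))

/-- The polynomial with the given list of coefficients. -/
def ofList : List ℕ → ℤ⟦X⟧
  | [] => 0
  | a :: l => PowerSeries.C (a : ℤ) + PowerSeries.X * ofList l

/-- Addition of coefficient lists. -/
def addL : List ℕ → List ℕ → List ℕ
  | [], l => l
  | a :: k, [] => a :: k
  | a :: k, b :: l => (a + b) :: addL k l

/-- Multiplication of coefficient lists. -/
def mulL : List ℕ → List ℕ → List ℕ
  | [], _ => []
  | a :: k, l => addL (l.map (a * ·)) (0 :: mulL k l)

/-- Reduction of a coefficient list modulo `128` and modulo `X^41`. -/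
def redL (l : List ℕ) : List ℕ := (l.take 41).map (· % 128)

/-- Powers of coefficient lists, reduced. -/
def powL (l : List ℕ) : ℕ → List ℕ
  | 0 => [1]
  | n + 1 => redL (mulL (powL l n) l)

/-- Squares of coefficient lists, reduced. -/
def sqL (l : List ℕ) : List ℕ := redL (mulL l l)

/-- The coefficient list of `eulerProd K`, reduced. -/
def eulerL : ℕ → List ℕ
  | 0 => [1]
  | K + 1 => redL (mulL (eulerL K) (1 :: (List.replicate K 0 ++ [127])))

/-- The numbers of partitions of `0, …, 40`. -/
def partL : List ℕ := [1, 1, 2, 3, 5, 7, 11, 15, 22, 30, 42, 56, 77, 101, 135, 176, 231, 297, 385,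
  490, 627, 792, 1002, 1255, 1575, 1958, 2436, 3010, 3718, 4565, 5604, 6842, 8349, 10143, 12310,
  14883, 17977, 21637, 26015, 31185, 37338]

lemma coeff_ofList (l : List ℕ) (n : ℕ) : coeff n (ofList l) = (l.getD n 0 : ℤ) := by
  induction l generalizing n with
  | nil => simp [ofList]
  | cons a l ih =>
    cases n with
    | zero => simp [ofList]
    | succ n => rw [ofList, map_add, PowerSeries.coeff_succ_X_mul, ih, PowerSeries.coeff_C]; simp

lemma ofList_addL (k l : List ℕ) : ofList (addL k l) = ofList k + ofList l := by
  induction k generalizing l with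
  | nil => simp [addL, ofList]
  | cons a k ih =>
    cases l with
    | nil => simp [addL, ofList]
    | cons b l => simp only [addL, ofList, ih, Nat.cast_add, map_add]; ring

lemma ofList_map_mul (a : ℕ) (l : List ℕ) :
    ofList (l.map (a * ·)) = PowerSeries.C (a : ℤ) * ofList l := by
  induction l with
  | nil => simp [ofList]
  | cons b l ih => simp only [List.map_cons, ofList, ih, Nat.cast_mul, map_mul]; ring

lemma ofList_mulL (k l : List ℕ) : ofList (mulL k l) = ofList k * ofList l := by
  induction k with
  | nil => simp [mulL, ofList]
  | cons a k ih =>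
    simp only [mulL, ofList_addL, ofList_map_mul, ofList, ih, Nat.cast_zero, map_zero]; ring

lemma X_pow_dvd_ofList_sub_take (n : ℕ) (l : List ℕ) :
    (PowerSeries.X ^ n : ℤ⟦X⟧) ∣ ofList l - ofList (l.take n) := by
  induction n generalizing l with
  | zero => simp
  | succ n ih =>
    cases l with
    | nil => simp
    | cons a l =>
      simpa only [List.take_succ_cons, ofList, add_sub_add_left_eq_sub, ← mul_sub, pow_succ'] using
        mul_dvd_mul_left _ (ih l)

lemma C_dvd_ofList_sub_map_mod (l : List ℕ) :
    (PowerSeries.C 128 : ℤ⟦X⟧) ∣ ofList l - ofList (l.map (· % 128)) := by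
  induction l with
  | nil => simp [ofList]
  | cons a l ih =>
    have h : (128 : ℤ) ∣ (a : ℤ) - ((a % 128 : ℕ) : ℤ) := by omega
    simp only [List.map_cons, ofList]
    rw [add_sub_add_comm, ← map_sub, ← mul_sub]
    exact dvd_add (map_dvd _ h) (ih.mul_left _)

local notation "π" => Ideal.Quotient.mk truncIdeal

lemma mk_ofList_redL (l : List ℕ) : π (ofList (redL l)) = π (ofList l) := by
  rw [eq_comm, Ideal.Quotient.eq, ← sub_add_sub_cancel _ (ofList (l.take 41)) _]
  exact add_mem (mem_truncIdeal_of_X_pow_dvd (X_pow_dvd_ofList_sub_take 41 l))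
    (mem_truncIdeal_of_C_dvd (C_dvd_ofList_sub_map_mod _))

lemma mk_ofList_powL (l : List ℕ) (n : ℕ) : π (ofList (powL l n)) = π (ofList l) ^ n := by
  induction n with
  | zero => simp [powL, ofList]
  | succ n ih => rw [powL, mk_ofList_redL, ofList_mulL, map_mul, ih, pow_succ]

lemma mk_ofList_iterate_sqL (l : List ℕ) (n : ℕ) :
    π (ofList (sqL^[n] l)) = π (ofList l) ^ 2 ^ n := by
  induction n with
  | zero => simp
  | succ n ih =>
    rw [Function.iterate_succ_apply', sqL, mk_ofList_redL, ofList_mulL, map_mul, ih, pow_succ 2,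
      pow_mul, sq]

lemma ofList_replicate_append (n a : ℕ) :
    ofList (List.replicate n 0 ++ [a]) = PowerSeries.C (a : ℤ) * PowerSeries.X ^ n := by
  induction n with
  | zero => simp [ofList]
  | succ n ih =>
    rw [List.replicate_succ, List.cons_append, ofList, ih, Nat.cast_zero, map_zero]; ring

lemma mk_ofList_eulerL (K : ℕ) : π (ofList (eulerL K)) = π (eulerProd K) := by
  induction K with
  | zero => simp [eulerL, ofList, eulerProd]
  | succ K ih =>
    rw [eulerL, mk_ofList_redL, ofList_mulL, map_mul, ih, eulerProd_succ, map_mul]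
    congr 1
    rw [Ideal.Quotient.eq, ofList, ofList_replicate_append]
    refine mem_truncIdeal_of_C_dvd ⟨PowerSeries.X ^ (K + 1), ?_⟩
    have : (PowerSeries.C 128 : ℤ⟦X⟧) = PowerSeries.C 127 + 1 := by
      rw [← map_one PowerSeries.C, ← map_add]; norm_num
    rw [this]
    simp only [Nat.cast_one, map_one, Nat.cast_ofNat]
    ring

lemma mk_eulerProd_add (n : ℕ) : π (eulerProd (n + 40)) = π (eulerProd 40) := by
  induction n with
  | zero => simp
  | succ n ih =>
    have h : π (PowerSeries.X ^ (n + 40 + 1)) = 0 :=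
      Ideal.Quotient.eq_zero_iff_mem.2
        (mem_truncIdeal_of_X_pow_dvd (pow_dvd_pow _ (by omega)))
    rw [show n + 1 + 40 = n + 40 + 1 by ring, eulerProd_succ, map_mul, map_sub, h, ih]
    simp

lemma mk_inv_eulerProd {n : ℕ} {V : ℤ⟦X⟧} (hV : eulerProd (n + 40) * V = 1) :
    π V = π (ofList partL) := by
  have h0 : ∀ k, ofList (List.replicate k 0) = 0 := fun k ↦ by
    induction k with
    | zero => rfl
    | succ k ih => simp [List.replicate_succ, ofList, ih]
  have hl : redL (mulL partL (eulerL 40)) = 1 :: List.replicate 40 0 := by decide +kernel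
  have h1 : π (ofList partL) * π (eulerProd 40) = 1 := by
    rw [← mk_ofList_eulerL, ← map_mul, ← ofList_mulL, ← mk_ofList_redL, hl, ofList, h0]
    simp
  have h2 : π (eulerProd 40) * π V = 1 := by rw [← mk_eulerProd_add n, ← map_mul, hV, map_one]
  exact (left_inv_eq_right_inv h1 h2).symm

lemma dvd_coeff_inv_sub {n : ℕ} {V : ℤ⟦X⟧} (hV : eulerProd (n + 40) * V = 1) (x D : ℕ)
    (hxD : 2 ^ x * D < 41) :
    (128 : ℤ) ∣ coeff (2 ^ x * D) (V ^ (24 * (2 ^ x * D))) -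
      ((sqL^[x + 3] (powL partL (3 * D))).getD (2 ^ x * D) 0 : ℕ) := by
  rw [← coeff_ofList, ← map_sub]
  refine dvd_coeff_of_mem_truncIdeal (Ideal.Quotient.eq.1 ?_) hxD
  rw [mk_ofList_iterate_sqL, mk_ofList_powL, ← mk_inv_eulerProd hV, ← pow_mul, map_pow]
  congr 1
  ring

lemma coeff_inv_one {n : ℕ} {V : ℤ⟦X⟧} (hV : eulerProd (n + 40) * V = 1) (x : ℕ) :
    (16 : ℤ) ∣ coeff (2 ^ x * 1) (V ^ (24 * (2 ^ x * 1))) - 8 := by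
  have hsq := two_dvd_inv_sq_sub_expand hV (two_dvd_eulerProd_sq_sub_expand _)
  induction x with
  | zero =>
    have h := dvd_coeff_inv_sub hV 0 1 (by norm_num)
    rw [show (sqL^[0 + 3] (powL partL (3 * 1))).getD (2 ^ 0 * 1) 0 = 24 by decide +kernel] at h
    have := (show (16 : ℤ) ∣ 128 by norm_num).trans h
    push_cast at this
    omega
  | succ x ih =>
    have h := coeff_doubling hsq x 1
    have : (16 : ℤ) ∣ 2 ^ (x + 4) := ⟨2 ^ x, by ring⟩
    have := this.trans h
    omega

lemma coeff_inv_three_five {n : ℕ} {V : ℤ⟦X⟧} (hV : eulerProd (n + 40) * V = 1) (x D : ℕ)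
    (hD : D = 3 ∨ D = 5) :
    (128 : ℤ) ∣ coeff (2 ^ x * D) (V ^ (24 * (2 ^ x * D))) - 64 := by
  have hsq := two_dvd_inv_sq_sub_expand hV (two_dvd_eulerProd_sq_sub_expand _)
  have key : ∀ y ≤ 3, (sqL^[y + 3] (powL partL (3 * D))).getD (2 ^ y * D) 0 = 64 := by
    rcases hD with rfl | rfl <;> decide +kernel
  have base : ∀ y ≤ 3, (128 : ℤ) ∣ coeff (2 ^ y * D) (V ^ (24 * (2 ^ y * D))) - 64 := by
    intro y hy
    have h := dvd_coeff_inv_sub hV y D (by interval_cases y <;> omega)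
    rwa [key y hy] at h
  rcases le_or_gt x 3 with hx | hx
  · exact base x hx
  · induction x, hx.le using Nat.le_induction with
    | base => exact base 3 le_rfl
    | succ x hx3 ih =>
      have h := coeff_doubling hsq x D
      have h128 : (128 : ℤ) ∣ 2 ^ (x + 4) := pow_dvd_pow (2 : ℤ) (show 7 ≤ x + 4 by omega)
      have := h128.trans h
      rcases hx3.eq_or_lt with rfl | hlt
      · have := base 3 le_rfl
        omega
      · have := ih hlt
        omega

lemma exists_qexp_eq {q : ℂ} (hq : ‖q‖ < 1) (hq0 : q ≠ 0) : ∃ z : ℍ, qexp z = q := by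
  refine ⟨⟨Function.Periodic.invQParam 1 q,
    Function.Periodic.im_invQParam_pos_of_norm_lt_one one_pos hq hq0⟩, ?_⟩
  simpa [Function.Periodic.qParam, qexp] using
    Function.Periodic.qParam_right_inv (h := 1) one_ne_zero hq0

lemma multipliable_one_sub_pow_add (K : ℕ) {q : ℂ} (hq : ‖q‖ < 1) :
    Multipliable fun n : ℕ ↦ 1 - q ^ (n + K + 1) := by
  simp_rw [sub_eq_add_neg]
  refine multipliable_one_add_of_summable ?_
  simpa [add_assoc] using
    (summable_nat_add_iff (K + 1)).mpr (summable_geometric_of_lt_one (norm_nonneg _) hq)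

lemma norm_tprod_one_sub_pow_sub_one_le (K : ℕ) {q : ℂ} (hq : ‖q‖ ≤ 1 / 2) :
    ‖∏' n : ℕ, (1 - q ^ (n + K + 1)) - 1‖ ≤ 4 * ‖q‖ ^ (K + 1) := by
  have hm := (multipliable_one_sub_pow_add K (hq.trans_lt (by norm_num))).hasProd
  refine le_of_tendsto ((hm.sub_const 1).norm) (Eventually.of_forall fun t ↦ ?_)
  have hs := summable_geometric_of_lt_one (norm_nonneg q) (hq.trans_lt (by norm_num))
  have h1 : ∑ n ∈ t, ‖-q ^ (n + K + 1)‖ ≤ 2 * ‖q‖ ^ (K + 1) := by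
    calc ∑ n ∈ t, ‖-q ^ (n + K + 1)‖ = (∑ n ∈ t, ‖q‖ ^ n) * ‖q‖ ^ (K + 1) := by
          rw [Finset.sum_mul]
          exact Finset.sum_congr rfl fun n _ ↦ by rw [norm_neg, norm_pow, add_assoc, pow_add]
      _ ≤ 2 * ‖q‖ ^ (K + 1) := by
          gcongr
          refine (hs.sum_le_tsum t fun _ _ ↦ by positivity).trans ?_
          rw [tsum_geometric_of_lt_one (norm_nonneg q) (hq.trans_lt (by norm_num))]
          exact inv_le_of_inv_le₀ (by norm_num) (by linarith)
  have h2 : ‖q‖ ^ (K + 1) ≤ 1 / 2 :=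
    (pow_le_of_le_one (norm_nonneg _) (by linarith) (by simp)).trans hq
  set x := ∑ n ∈ t, ‖-q ^ (n + K + 1)‖ with hx
  have hx0 : 0 ≤ x := Finset.sum_nonneg fun _ _ ↦ norm_nonneg _
  have h3 := Real.abs_exp_sub_one_le (x := x) (by rw [abs_of_nonneg hx0]; linarith)
  have h4 := t.norm_prod_one_add_sub_one_le fun n ↦ -q ^ (n + K + 1)
  simp only [← sub_eq_add_neg] at h4
  rw [abs_of_nonneg hx0] at h3
  linarith [le_abs_self (Real.exp x - 1)]

lemma tprod_one_sub_pow_ne_zero {q : ℂ} (hq : ‖q‖ < 1) : ∏' n : ℕ, (1 - q ^ (n + 1)) ≠ 0 := by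
  simp_rw [sub_eq_add_neg]
  refine tprod_one_add_ne_zero_of_summable (fun n h ↦ ?_) ?_
  · have h1 : q ^ (n + 1) = 1 := by linear_combination -h
    have h2 := pow_lt_one₀ (norm_nonneg q) hq n.succ_ne_zero
    rw [← norm_pow, h1, norm_one] at h2
    exact lt_irrefl _ h2
  · simpa using (summable_nat_add_iff 1).mpr (summable_geometric_of_lt_one (norm_nonneg _) hq)

lemma tprod_inv_one_sub_pow {q : ℂ} (hq : ‖q‖ < 1) (N : ℕ) :
    ∏' m : ℕ+, ((1 - q ^ (m : ℕ)) ^ N)⁻¹ = ((∏' n : ℕ, (1 - q ^ (n + 1))) ^ N)⁻¹ := by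
  have hm : Multipliable fun n : ℕ ↦ 1 - q ^ (n + 1) := multipliable_one_sub_pow_add 0 hq
  rw [tprod_pnat_eq_tprod_succ (f := fun m ↦ ((1 - q ^ m) ^ N)⁻¹), ← hm.tprod_pow,
    (hm.pow N).tprod_inv₀]
  rw [hm.tprod_pow]
  exact pow_ne_zero _ (tprod_one_sub_pow_ne_zero hq)

/-- A convergent power series agrees with its partial sums up to the expected order. -/
lemma isBigO_tsum_sub_sum {a : ℕ → ℂ} {r : ℂ} (hr : r ≠ 0) (ha : Summable fun n ↦ a n * r ^ n)
    (k : ℕ) : (fun q : ℂ ↦ ∑' n, a n * q ^ n - ∑ n ∈ Finset.range k, a n * q ^ n) =O[𝓝[≠] 0]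
      fun q ↦ q ^ k := by
  have hsum : Summable fun n ↦ ‖a (n + k)‖ * ‖r‖ ^ n := by
    have := ((summable_nat_add_iff k).2 ha.norm).mul_right (‖r‖ ^ k)⁻¹
    refine this.congr fun n ↦ ?_
    have : ‖r‖ ≠ 0 := norm_ne_zero_iff.2 hr
    rw [norm_mul, norm_pow, pow_add]
    field_simp
  refine IsBigO.of_bound (∑' n, ‖a (n + k)‖ * ‖r‖ ^ n) ?_
  have hev : ∀ᶠ q : ℂ in 𝓝[≠] 0, ‖q‖ < ‖r‖ := by
    refine nhdsWithin_le_nhds ?_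
    filter_upwards [Metric.ball_mem_nhds (0 : ℂ) (norm_pos_iff.2 hr)] with q hq
    simpa using hq
  filter_upwards [hev] with q hq
  have hq' : Summable fun n ↦ a n * q ^ n := by
    refine Summable.of_norm_bounded ha.norm fun n ↦ ?_
    rw [norm_mul, norm_mul, norm_pow, norm_pow]
    gcongr
  have hb : ∀ n, ‖a (n + k) * q ^ n‖ ≤ ‖a (n + k)‖ * ‖r‖ ^ n := fun n ↦ by
    rw [norm_mul, norm_pow]
    gcongr
  rw [← hq'.sum_add_tsum_nat_add k, add_sub_cancel_left]
  simp_rw [pow_add, ← mul_assoc]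
  rw [tsum_mul_right, norm_mul]
  gcongr
  exact tsum_of_norm_bounded hsum.hasSum hb

lemma X_pow_dvd_of_isBigO {p : Polynomial ℂ} {n : ℕ}
    (h : (fun q ↦ p.eval q) =O[𝓝[≠] 0] fun q : ℂ ↦ q ^ n) : Polynomial.X ^ n ∣ p := by
  induction n with
  | zero => simp
  | succ n ih =>
    have hle : (fun q : ℂ ↦ q ^ (n + 1)) =O[𝓝[≠] 0] fun q : ℂ ↦ q ^ n :=
      (isBigO_refl (fun q : ℂ ↦ q ^ n) (𝓝[≠] 0)).mul
        ((tendsto_id.mono_left nhdsWithin_le_nhds).isBigO_one ℂ) |>.congr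
          (fun q ↦ (pow_succ q n).symm) (fun q ↦ mul_one _)
    obtain ⟨g, rfl⟩ := ih (h.trans hle)
    have hg : (fun q ↦ g.eval q) =O[𝓝[≠] 0] fun q : ℂ ↦ q := by
      refine ((isBigO_refl (fun q : ℂ ↦ (q ^ n)⁻¹) _).mul h).congr' ?_ ?_ <;>
      · filter_upwards [self_mem_nhdsWithin] with q hq
        have : q ≠ 0 := hq
        simp [pow_succ, this]
    have h0 : Tendsto (fun q ↦ g.eval q) (𝓝[≠] 0) (𝓝 0) :=
      hg.trans_tendsto (tendsto_id.mono_left nhdsWithin_le_nhds)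
    have h1 : Tendsto (fun q ↦ g.eval q) (𝓝[≠] 0) (𝓝 (g.eval 0)) :=
      g.continuous.continuousAt.tendsto.mono_left nhdsWithin_le_nhds
    have h2 : g.eval 0 = 0 := tendsto_nhds_unique h1 h0
    rw [pow_succ]
    exact mul_dvd_mul_left _ (Polynomial.X_dvd_iff.2 (by rwa [Polynomial.coeff_zero_eq_eval_zero]))

lemma isBigO_pow_sub_one {f : ℂ → ℂ} {g : ℂ → ℂ} {l : Filter ℂ} (hf : Tendsto f l (𝓝 1))
    (h : (fun q ↦ f q - 1) =O[l] g) (N : ℕ) : (fun q ↦ f q ^ N - 1) =O[l] g :=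
  (((hasDerivAt_pow N (1 : ℂ)).isBigO_sub.comp_tendsto hf).congr_left (by simp)).trans h

/-- The analytic identity `Π(1−qᵐ)^{−N} = Σ R_n qⁿ` determines `R` modulo `X^k` formally. -/
lemma X_pow_dvd_mk_mul_eulerProd_pow {N : ℕ} {R : ℕ → ℤ}
    (hexp : ∀ z : ℍ, (∏' m : ℕ+, ((1 - qexp (z : ℂ) ^ (m : ℕ)) ^ N)⁻¹) =
      ∑' n : ℕ, (R n : ℂ) * qexp (z : ℂ) ^ n) (K : ℕ) :
    (PowerSeries.X ^ (K + 1) : ℤ⟦X⟧) ∣ PowerSeries.mk R * eulerProd K ^ N - 1 := by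
  have hf : ∀ q : ℂ, ‖q‖ < 1 → q ≠ 0 →
      ((∏' n : ℕ, (1 - q ^ (n + 1))) ^ N)⁻¹ = ∑' n : ℕ, (R n : ℂ) * q ^ n := by
    intro q hq hq0
    obtain ⟨z, rfl⟩ := exists_qexp_eq hq hq0
    rw [← tprod_inv_one_sub_pow hq, hexp]
  have hsum : Summable fun n ↦ (R n : ℂ) * (1 / 2 : ℂ) ^ n := by
    by_contra h
    have h2 : ‖(1 / 2 : ℂ)‖ < 1 := by norm_num
    have := hf (1 / 2) h2 (by norm_num)
    rw [tsum_eq_zero_of_not_summable h] at this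
    exact inv_ne_zero (pow_ne_zero _ (tprod_one_sub_pow_ne_zero h2)) this
  have htail := isBigO_tsum_sub_sum (by norm_num) hsum (K + 1)
  set T : Polynomial ℤ := 
    ∑ n ∈ Finset.range (K + 1), Polynomial.C (R n) * Polynomial.X ^ n with hT
  set Q : Polynomial ℤ := ∏ m ∈ Finset.range K, (1 - Polynomial.X ^ (m + 1)) with hQ
  have hTe : ∀ q : ℂ, (T.map (Int.castRingHom ℂ)).eval q =
      ∑ n ∈ Finset.range (K + 1), (R n : ℂ) * q ^ n := fun q ↦ by
    simp [hT, Polynomial.map_sum, Polynomial.eval_finsetSum]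
  have hQe : ∀ q : ℂ, (Q.map (Int.castRingHom ℂ)).eval q =
      ∏ n ∈ Finset.range K, (1 - q ^ (n + 1)) := fun q ↦ by
    simp [hQ, Polynomial.map_prod, Polynomial.eval_prod]
  have hQC : (Q : ℤ⟦X⟧) = eulerProd K := by
    rw [hQ, eulerProd, ← Polynomial.coeToPowerSeries.ringHom_apply, map_prod]
    simp
  set t : ℂ → ℂ := fun q ↦ ∏' n : ℕ, (1 - q ^ (n + K + 1)) with ht
  have hsmall : ∀ᶠ q : ℂ in 𝓝[≠] 0, ‖q‖ ≤ 1 / 2 := nhdsWithin_le_nhds <| by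
    filter_upwards [Metric.closedBall_mem_nhds (0 : ℂ) (by norm_num : (0 : ℝ) < 1 / 2)] with q hq
    simpa using hq
  have htO : (fun q ↦ t q - 1) =O[𝓝[≠] 0] fun q ↦ q ^ (K + 1) :=
    IsBigO.of_bound 4 <| hsmall.mono fun q hq ↦ by
      simpa using norm_tprod_one_sub_pow_sub_one_le K hq
  have hXK : Tendsto (fun q : ℂ ↦ q ^ (K + 1)) (𝓝[≠] 0) (𝓝 0) :=
    ((continuous_pow (K + 1)).tendsto' (0 : ℂ) 0 (by simp)).mono_left nhdsWithin_le_nhds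
  have ht1 : Tendsto t (𝓝[≠] 0) (𝓝 1) := by
    simpa using (htO.trans_tendsto hXK).add_const 1
  have hpoly : ∀ p : Polynomial ℂ, (fun q ↦ p.eval q) =O[𝓝[≠] 0] fun _ ↦ (1 : ℂ) := fun p ↦
    (p.continuous.continuousAt.tendsto.mono_left nhdsWithin_le_nhds).isBigO_one ℂ
  have key : (fun q ↦ ((T * Q ^ N - 1).map (Int.castRingHom ℂ)).eval q) =O[𝓝[≠] 0]
      fun q : ℂ ↦ q ^ (K + 1) := by
    have h1 := (htail.mul (hpoly ((Q.map (Int.castRingHom ℂ)) ^ N))).mul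
      ((ht1.pow N).isBigO_one ℂ)
    have h2 := (hpoly ((T * Q ^ N).map (Int.castRingHom ℂ))).mul (isBigO_pow_sub_one ht1 htO N)
    simp only [mul_one, one_mul] at h1 h2
    refine (h1.add h2).neg_left.congr' ?_ EventuallyEq.rfl
    filter_upwards [hsmall, self_mem_nhdsWithin] with q hq hq0
    have hq1 : ‖q‖ < 1 := hq.trans_lt (by norm_num)
    have hg : (∏ n ∈ Finset.range K, (1 - q ^ (n + 1))) * t q = ∏' n : ℕ, (1 - q ^ (n + 1)) :=
      (multipliable_one_sub_pow_add K hq1).prod_mul_tprod_nat_mul' (f := fun n ↦ 1 - q ^ (n + 1))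
    have hg0 := tprod_one_sub_pow_ne_zero hq1
    rw [← hf q hq1 hq0, ← hTe]
    simp only [Polynomial.map_sub, Polynomial.map_mul, Polynomial.map_pow, Polynomial.map_one,
      Polynomial.eval_sub, Polynomial.eval_mul, Polynomial.eval_pow, Polynomial.eval_one]
    rw [← hQe] at hg
    rw [← hg] at hg0 ⊢
    have := pow_ne_zero N hg0
    rw [mul_pow] at this ⊢
    linear_combination -(inv_mul_cancel₀ this)
  have hdvd : (Polynomial.X ^ (K + 1) : Polynomial ℤ) ∣ T * Q ^ N - 1 := by
    have h := X_pow_dvd_of_isBigO key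
    rw [Polynomial.X_pow_dvd_iff] at h ⊢
    intro d hd
    have := h d hd
    rw [Polynomial.coeff_map] at this
    exact Int.cast_eq_zero.1 this
  have h1 : (PowerSeries.X ^ (K + 1) : ℤ⟦X⟧) ∣ T * eulerProd K ^ N - 1 := by
    have := map_dvd (Polynomial.coeToPowerSeries.ringHom (R := ℤ)) hdvd
    simpa [hQC] using this
  have h2 : (PowerSeries.X ^ (K + 1) : ℤ⟦X⟧) ∣ PowerSeries.mk R - T := by
    rw [PowerSeries.X_pow_dvd_iff]
    intro m hm
    rw [map_sub, PowerSeries.coeff_mk, Polynomial.coeff_coe, hT, Polynomial.finsetSum_coeff]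
    simp [Polynomial.coeff_X_pow, hm]
  convert (h2.mul_right (eulerProd K ^ N)).add h1 using 1
  ring

lemma padicValInt_two_eq_of_dvd_sub {r : ℤ} {k : ℕ} (h : (2 : ℤ) ^ (k + 1) ∣ r - 2 ^ k) :
    padicValInt 2 r = k := by
  obtain ⟨c, hc⟩ := h
  have hr : r = 2 ^ k * (1 + 2 * c) := by linear_combination hc
  have hodd : ¬ (2 : ℤ) ∣ 1 + 2 * c := by omega
  have h0 : (1 + 2 * c : ℤ) ≠ 0 := by omega
  rw [hr, padicValInt.mul (by positivity) h0,
    padicValInt.eq_zero_of_not_dvd (z := 1 + 2 * c) (by exact_mod_cast hodd), add_zero]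
  simp [padicValInt, Int.natAbs_pow]

lemma sum_digits_two_pow_mul (x D : ℕ) (hD : 0 < D) :
    (Nat.digits 2 (2 ^ x * D)).sum = (Nat.digits 2 D).sum := by
  rw [Nat.digits_base_pow_mul one_lt_two hD]
  simp

/-- Theorem 4.2: for `s = 2^x·D` with `D ∈ {1,3,5}`, the constant term `c₀[Δ^{−s}]` (the
coefficient of `qˢ` in `Π_{m≥1}(1−qᵐ)^{−24s}`) has 2-adic valuation exactly `3·d₂(s)`,
where `d₂(s)` is the sum of the binary digits of `s`. -/
theorem stmt17 (x D : ℕ) (hD : D = 1 ∨ D = 3 ∨ D = 5) (R : ℕ → ℤ)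
    (hexp : ∀ z : ℍ,
      (∏' m : ℕ+, ((1 - qexp (z : ℂ) ^ (m : ℕ)) ^ (24 * (2 ^ x * D)))⁻¹) =
        ∑' n : ℕ, (R n : ℂ) * qexp (z : ℂ) ^ n) :
    padicValInt 2 (R (2 ^ x * D)) = 3 * (Nat.digits 2 (2 ^ x * D)).sum := by
  obtain ⟨V, hV⟩ := (isUnit_eulerProd (2 ^ x * D + 40)).exists_right_inv
  have hR : R (2 ^ x * D) = coeff (2 ^ x * D) (V ^ (24 * (2 ^ x * D))) := by
    have h := (X_pow_dvd_mk_mul_eulerProd_pow hexp (2 ^ x * D + 40)).mul_right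
      (V ^ (24 * (2 ^ x * D)))
    rw [sub_mul, mul_assoc, ← mul_pow, hV, one_pow, mul_one, one_mul,
      PowerSeries.X_pow_dvd_iff] at h
    have := h (2 ^ x * D) (by omega)
    rw [map_sub, PowerSeries.coeff_mk] at this
    linarith
  rw [hR, sum_digits_two_pow_mul x D (by omega)]
  rcases hD with rfl | hD
  · rw [padicValInt_two_eq_of_dvd_sub (k := 3) (by simpa using coeff_inv_one hV x)]
    simp
  · rw [padicValInt_two_eq_of_dvd_sub (k := 6) (by simpa using coeff_inv_three_five hV x D hD)]
    rcases hD with rfl | rfl <;> simp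

end
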